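/- arXiv:1707.06254 — 2 statements merged into one kernel-verified Lean document; each statement's English description precedes it below -/
import Mathlib

section
/- For integers 1 ≤ j < k, let f_{j,k}(x) = (jk/(k−j))(e^{jx} − e^{kx}) and f_j(x) = j e^{jx} for x ≤ 0 (both densities vanishing for x > 0). Then the Kullback-Leibler divergence D_KL(f_{j,k} ‖ f_j) = ∫_{−∞}^0 f_{j,k}(x) log(f_{j,k}(x)/f_j(x)) dx equals log(k/(k−j)) + ψ(1) + (j/(k−j)) ψ(1 + k/(k−j)) − (k/(k−j)) ψ(1 + j/(k−j)), where ψ is the digamma function. -/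
open MeasureTheory ProbabilityTheory Real Filter

/-- The digamma function `ψ(x) = Γ'(x)/Γ(x)`. -/
noncomputable def digamma (x : ℝ) : ℝ := deriv Real.Gamma x / Real.Gamma x

theorem integral_Ioo_rpow_mul_one_sub_rpow {a b : ℝ} (ha : 0 < a) (hb : 0 < b) :
    ∫ t in Set.Ioo (0 : ℝ) 1, t ^ (a - 1) * (1 - t) ^ (b - 1) = beta a b := by
  rw [beta_eq_betaIntegralReal a b ha hb, Complex.betaIntegral,
    intervalIntegral.integral_of_le zero_le_one, integral_Ioc_eq_integral_Ioo]
  have h : ∀ t ∈ Set.Ioo (0 : ℝ) 1, (t : ℂ) ^ ((a : ℂ) - 1) * (1 - (t : ℂ)) ^ ((b : ℂ) - 1)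
      = ((t ^ (a - 1) * (1 - t) ^ (b - 1) : ℝ) : ℂ) := fun t ht => by
    have h1 : 0 ≤ 1 - t := by linarith [ht.2]
    push_cast [Complex.ofReal_cpow ht.1.le, Complex.ofReal_cpow h1]
    rfl
  rw [setIntegral_congr_fun measurableSet_Ioo h, integral_complex_ofReal, Complex.ofReal_re]

theorem integrableOn_Ioo_rpow_sub_one {a : ℝ} (ha : 0 < a) :
    IntegrableOn (fun t : ℝ => t ^ (a - 1)) (Set.Ioo 0 1) :=
  (intervalIntegral.integrableOn_Ioo_rpow_iff zero_lt_one).2 (by linarith)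

theorem hasDerivAt_Gamma {s : ℝ} (hs : 0 < s) :
    HasDerivAt Real.Gamma (digamma s * Real.Gamma s) s := by
  rw [digamma, div_mul_cancel₀ _ (Real.Gamma_pos_of_pos hs).ne']
  refine (Real.differentiableAt_Gamma fun m => ?_).hasDerivAt
  have : (0 : ℝ) ≤ m := m.cast_nonneg
  linarith

theorem digamma_add_one {s : ℝ} (hs : 0 < s) : digamma (s + 1) = digamma s + 1 / s := by
  have h1 : HasDerivAt (fun x => Real.Gamma (x + 1))
      (digamma (s + 1) * Real.Gamma (s + 1)) s := by
    simpa using (hasDerivAt_Gamma (s := s + 1) (by linarith)).comp_add_const s 1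
  have h2 : HasDerivAt (fun x => x * Real.Gamma x)
      (1 * Real.Gamma s + s * (digamma s * Real.Gamma s)) s :=
    (hasDerivAt_id s).mul (hasDerivAt_Gamma hs)
  have h3 := h1.unique (h2.congr_of_eventuallyEq
    ((eventually_ne_nhds hs.ne').mono fun x hx => Real.Gamma_add_one hx))
  rw [Real.Gamma_add_one hs.ne'] at h3
  have hG := (Real.Gamma_pos_of_pos hs).ne'
  field_simp
  apply mul_right_cancel₀ hG
  linarith

theorem hasDerivAt_beta_right {a b : ℝ} (ha : 0 < a) (hb : 0 < b) :
    HasDerivAt (beta a) (beta a b * (digamma b - digamma (a + b))) b := by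
  have hG := (Real.Gamma_pos_of_pos (add_pos ha hb)).ne'
  have h := ((hasDerivAt_Gamma hb).const_mul (Real.Gamma a)).div
    ((hasDerivAt_Gamma (add_pos ha hb)).comp_const_add a b) hG
  refine h.congr_deriv ?_
  rw [beta]
  field_simp

theorem integral_Ioo_rpow_mul_one_sub_rpow_mul_log {a b : ℝ} (ha : 0 < a) (hb : 1 < b) :
    IntegrableOn (fun t : ℝ => t ^ (a - 1) * ((1 - t) ^ (b - 1) * log (1 - t))) (Set.Ioo 0 1) ∧
    ∫ t in Set.Ioo (0 : ℝ) 1, t ^ (a - 1) * ((1 - t) ^ (b - 1) * log (1 - t)) =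
      beta a b * (digamma b - digamma (a + b)) := by
  obtain ⟨c, hc, hcb⟩ := exists_between hb
  have hb0 : 0 < b := by linarith
  have hc0 : 0 < c - 1 := by linarith
  have key := hasDerivAt_integral_of_dominated_loc_of_deriv_le
    (μ := volume.restrict (Set.Ioo (0 : ℝ) 1)) (x₀ := b) (s := Set.Ioi c)
    (F := fun s t => t ^ (a - 1) * (1 - t) ^ (s - 1))
    (F' := fun s t => t ^ (a - 1) * ((1 - t) ^ (s - 1) * log (1 - t)))
    (bound := fun t => t ^ (a - 1) * (1 / (c - 1)))
    (Ioi_mem_nhds hcb) (.of_forall fun s => by fun_prop)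
    (by
      refine (integrableOn_Ioo_rpow_sub_one ha).mono' (by fun_prop) ?_
      refine (ae_restrict_iff' measurableSet_Ioo).2 (.of_forall fun t ht => ?_)
      have h1 : 0 < 1 - t := by linarith [ht.2]
      have h2 := rpow_pos_of_pos ht.1 (a - 1)
      rw [Real.norm_of_nonneg (by positivity)]
      exact mul_le_of_le_one_right h2.le
        (rpow_le_one h1.le (by linarith [ht.1]) (by linarith)))
    (by fun_prop)
    (by
      refine (ae_restrict_iff' measurableSet_Ioo).2 (.of_forall fun t ht s hs => ?_)
      have h1 : 0 < 1 - t := by linarith [ht.2]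
      have h2 := rpow_pos_of_pos ht.1 (a - 1)
      rw [norm_mul, Real.norm_of_nonneg h2.le]
      gcongr
      refine le_trans ?_ (abs_log_mul_self_rpow_lt (1 - t) (c - 1) h1 (by linarith [ht.1]) hc0).le
      rw [mul_comm, Real.norm_eq_abs, abs_mul, abs_mul, abs_of_pos (rpow_pos_of_pos h1 _),
        abs_of_pos (rpow_pos_of_pos h1 _)]
      exact mul_le_mul_of_nonneg_left (rpow_le_rpow_of_exponent_ge h1 (by linarith [ht.1])
        (by linarith [Set.mem_Ioi.1 hs])) (abs_nonneg _))
    ((integrableOn_Ioo_rpow_sub_one ha).mul_const _)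
    (by
      refine (ae_restrict_iff' measurableSet_Ioo).2 (.of_forall fun t ht s _ => ?_)
      have h1 : 0 < 1 - t := by linarith [ht.2]
      have h := (((hasDerivAt_id s).sub_const 1).const_rpow h1).const_mul (t ^ (a - 1))
      refine h.congr_deriv ?_
      simp only [id, mul_one]
      ring)
  refine ⟨key.1, key.2.unique ((hasDerivAt_beta_right ha hb0).congr_of_eventuallyEq ?_)⟩
  exact (eventually_gt_nhds hb0).mono fun s hs => integral_Ioo_rpow_mul_one_sub_rpow ha hs

theorem image_exp_mul_Iio {d : ℝ} (hd : 0 < d) :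
    (fun x => rexp (d * x)) '' Set.Iio 0 = Set.Ioo 0 1 := by
  ext t
  constructor
  · rintro ⟨x, hx, rfl⟩
    exact ⟨exp_pos _, Real.exp_lt_one_iff.2 (mul_neg_of_pos_of_neg hd hx)⟩
  · rintro ⟨h0, h1⟩
    refine ⟨log t / d, div_neg_of_neg_of_pos (log_neg h0 h1) hd, ?_⟩
    simp only [mul_div_cancel₀ _ hd.ne', exp_log h0]

theorem integral_Ioo_eq_integral_Iio_exp {d : ℝ} (hd : 0 < d) (g : ℝ → ℝ) :
    ∫ t in Set.Ioo (0 : ℝ) 1, g t =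
      ∫ x in Set.Iio (0 : ℝ), d * rexp (d * x) * g (rexp (d * x)) := by
  rw [← image_exp_mul_Iio hd,
    integral_image_eq_integral_abs_deriv_smul (f' := fun x => rexp (d * x) * d)
      measurableSet_Iio
      (fun x _ => by simpa using (((hasDerivAt_id x).const_mul d).exp).hasDerivWithinAt)
      (fun x _ y _ h => mul_left_cancel₀ hd.ne' (exp_injective h)) g]
  refine integral_congr_ae (.of_forall fun x => ?_)
  simp only [smul_eq_mul, abs_of_pos (mul_pos (exp_pos _) hd)]
  ring

/-- Kullback-Leibler divergence of `f_j` from `f_{j,k}`. -/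
theorem KL_div_fjk_fj (j k : ℕ) (hj : 1 ≤ j) (hjk : j < k) :
    (∫ x in Set.Iic (0 : ℝ),
        ((j : ℝ) * k / ((k : ℝ) - j) * (Real.exp ((j : ℝ) * x) - Real.exp ((k : ℝ) * x))) *
          Real.log
            (((j : ℝ) * k / ((k : ℝ) - j) *
                (Real.exp ((j : ℝ) * x) - Real.exp ((k : ℝ) * x))) /
              ((j : ℝ) * Real.exp ((j : ℝ) * x))))
      = Real.log ((k : ℝ) / ((k : ℝ) - j)) + digamma 1
        + (j : ℝ) / ((k : ℝ) - j) * digamma (1 + (k : ℝ) / ((k : ℝ) - j))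
        - (k : ℝ) / ((k : ℝ) - j) * digamma (1 + (j : ℝ) / ((k : ℝ) - j)) := by
  have hj0 : (0 : ℝ) < j := by exact_mod_cast hj
  have hd : (0 : ℝ) < k - j := sub_pos.2 (by exact_mod_cast hjk)
  obtain ⟨d, hdk⟩ : ∃ d : ℝ, d = k - j := ⟨_, rfl⟩
  have hk : (k : ℝ) = j + d := by linarith
  rw [← hdk] at hd ⊢
  rw [hk]
  generalize (j : ℝ) = p at *
  obtain ⟨a, ha⟩ : ∃ a : ℝ, a = p / d := ⟨_, rfl⟩
  have ha0 : 0 < a := by rw [ha]; positivity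
  obtain rfl : p = a * d := by rw [ha]; field_simp
  have hkd : (a * d + d) / d = a + 1 := by field_simp
  rw [hkd, mul_div_cancel_right₀ a hd.ne']
  have hc : 0 < a + 1 := by linarith
  have hbeta : beta a 2 = 1 / (a * (a + 1)) := by
    rw [beta, Real.Gamma_two, show a + 2 = a + 1 + 1 by ring, Real.Gamma_add_one hc.ne',
      Real.Gamma_add_one ha0.ne']
    have := (Real.Gamma_pos_of_pos ha0).ne'
    field_simp
  have hlog := integral_Ioo_rpow_mul_one_sub_rpow_mul_log ha0 one_lt_two
  have hone := integral_Ioo_rpow_mul_one_sub_rpow ha0 two_pos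
  have hint : IntegrableOn (fun t : ℝ => t ^ (a - 1) * (1 - t) ^ ((2 : ℝ) - 1))
      (Set.Ioo 0 1) := by
    refine Integrable.of_integral_ne_zero ?_
    rw [hone]
    exact (beta_pos ha0 two_pos).ne'
  obtain ⟨g, hg⟩ : ∃ g : ℝ → ℝ, g = fun t : ℝ => a * (a + 1) *
        (log (a + 1) * (t ^ (a - 1) * (1 - t) ^ ((2 : ℝ) - 1)) +
          t ^ (a - 1) * ((1 - t) ^ ((2 : ℝ) - 1) * log (1 - t))) := ⟨_, rfl⟩
  have hsub : ∀ x ∈ Set.Iio (0 : ℝ),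
      (a * d * (a * d + d) / d * (rexp (a * d * x) - rexp ((a * d + d) * x))) *
        log ((a * d * (a * d + d) / d * (rexp (a * d * x) - rexp ((a * d + d) * x))) /
          (a * d * rexp (a * d * x))) =
      d * rexp (d * x) * g (rexp (d * x)) := by
    intro x hx
    have h1 : 0 < 1 - rexp (d * x) :=
      sub_pos.2 (Real.exp_lt_one_iff.2 (mul_neg_of_pos_of_neg hd hx))
    have h2 : rexp ((a * d + d) * x) = rexp (a * d * x) * rexp (d * x) := by
      rw [← exp_add]; ring_nf
    have h3 : rexp (a * d * x) = rexp (d * x) * rexp (d * x) ^ (a - 1) := by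
      rw [← exp_mul, ← exp_add]; ring_nf
    have h4 : a * d * (a * d + d) / d * (rexp (a * d * x) - rexp ((a * d + d) * x)) /
        (a * d * rexp (a * d * x)) = (a + 1) * (1 - rexp (d * x)) := by
      rw [h2]
      have := (exp_pos (a * d * x)).ne'
      field_simp
    have h5 : (2 : ℝ) - 1 = 1 := by norm_num
    simp only [hg, h4, log_mul hc.ne' h1.ne', h5, rpow_one]
    rw [h2, h3]
    field_simp
  rw [integral_Iic_eq_integral_Iio, setIntegral_congr_fun measurableSet_Iio hsub,
    ← integral_Ioo_eq_integral_Iio_exp hd g, hg,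
    integral_const_mul, integral_add (hint.const_mul _) hlog.1, integral_const_mul, hone, hlog.2,
    hbeta, show a + 2 = a + 1 + 1 by ring, show 1 + (a + 1) = a + 1 + 1 by ring,
    digamma_add_one hc, show (2 : ℝ) = 1 + 1 by norm_num, digamma_add_one one_pos, add_comm 1 a]
  field_simp
  ring
end

section
/- For integers 1 ≤ j < k, let f_{j,k}(x) = (jk/(k−j))(e^{jx} − e^{kx}) and f_j(x) = j e^{jx} for x ≤ 0 (both densities vanishing for x > 0). Then the Kullback-Leibler divergence D_KL(f_j ‖ f_{j,k}) = ∫_{−∞}^0 f_j(x) log(f_j(x)/f_{j,k}(x)) dx equals −log(k/(k−j)) − ψ(1) + ψ(1 + j/(k−j)), where ψ is the digamma function. -/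
open MeasureTheory ProbabilityTheory Real Filter

theorem differentiableAt_Gamma_of_pos {x : ℝ} (hx : 0 < x) : DifferentiableAt ℝ Real.Gamma x :=
  Real.differentiableAt_Gamma fun m => by
    have : (0 : ℝ) ≤ m := m.cast_nonneg
    linarith

theorem deriv_log_Gamma {x : ℝ} (hx : 0 < x) : deriv (Real.log ∘ Real.Gamma) x = digamma x :=
  deriv.log (differentiableAt_Gamma_of_pos hx) (Real.Gamma_pos_of_pos hx).ne'

theorem digamma_monotoneOn : MonotoneOn digamma (Set.Ioi 0) := by
  refine (Real.convexOn_log_Gamma.monotoneOn_deriv fun x hx => ?_).congr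
    fun x hx => deriv_log_Gamma hx
  exact (differentiableAt_Gamma_of_pos hx).log (Real.Gamma_pos_of_pos hx).ne'

theorem digamma_add_one_s6 {x : ℝ} (hx : 0 < x) : digamma (x + 1) = digamma x + x⁻¹ := by
  have hG := (Real.Gamma_pos_of_pos hx).ne'
  have h : (fun y : ℝ => Real.Gamma (y + 1)) =ᶠ[nhds x] fun y => y * Real.Gamma y :=
    (eventually_ne_nhds hx.ne').mono fun y hy => Real.Gamma_add_one hy
  have h' := h.deriv_eq
  rw [deriv_comp_add_const,
    ((hasDerivAt_id' x).fun_mul (differentiableAt_Gamma_of_pos hx).hasDerivAt).deriv, one_mul] at h'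
  rw [digamma, digamma, h', Real.Gamma_add_one hx.ne']
  field_simp
  ring

theorem digamma_add_nat {x : ℝ} (hx : 0 < x) (n : ℕ) :
    digamma (x + n) = digamma x + ∑ i ∈ Finset.range n, (x + i)⁻¹ := by
  induction n with
  | zero => simp
  | succ n ih =>
    rw [Nat.cast_succ, ← add_assoc, digamma_add_one_s6 (by positivity), ih,
      Finset.sum_range_succ, add_assoc]

theorem tendsto_digamma_add_nat_sub {a : ℝ} (ha : 0 ≤ a) :
    Tendsto (fun n : ℕ => digamma (1 + a + n) - digamma (1 + n)) atTop (nhds 0) := by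
  obtain ⟨m, hm⟩ := exists_nat_ge a
  have hlim : Tendsto (fun n : ℕ => (m : ℝ) * (1 / ((n : ℝ) + 1))) atTop (nhds 0) := by
    simpa using tendsto_one_div_add_atTop_nhds_zero_nat.const_mul (m : ℝ)
  refine squeeze_zero (fun n => ?_) (fun n => ?_) hlim
  · refine sub_nonneg.2 (digamma_monotoneOn (Set.mem_Ioi.2 ?_) (Set.mem_Ioi.2 ?_) ?_)
    · positivity
    · positivity
    · linarith
  · have hpos : (0 : ℝ) < 1 + n := by positivity
    have hle : digamma (1 + a + n) ≤ digamma (1 + n + m) :=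
      digamma_monotoneOn (Set.mem_Ioi.2 (by positivity)) (Set.mem_Ioi.2 (by positivity))
        (by linarith)
    rw [digamma_add_nat hpos] at hle
    have hsum : ∑ i ∈ Finset.range m, ((1 : ℝ) + n + i)⁻¹ ≤ m * (1 / ((n : ℝ) + 1)) := by
      refine (Finset.sum_le_card_nsmul _ _ (1 / ((n : ℝ) + 1)) fun i _ => ?_).trans_eq (by simp)
      rw [inv_eq_one_div]
      refine one_div_le_one_div_of_le (by positivity) ?_
      have : (0 : ℝ) ≤ i := i.cast_nonneg
      linarith
    linarith

theorem hasSum_digamma_one_add_sub {a : ℝ} (ha : 0 ≤ a) :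
    HasSum (fun n : ℕ => ((1 : ℝ) + n)⁻¹ - (1 + a + n)⁻¹) (digamma (1 + a) - digamma 1) := by
  rw [hasSum_iff_tendsto_nat_of_nonneg]
  · have h := (tendsto_digamma_add_nat_sub ha).const_sub (digamma (1 + a) - digamma 1)
    rw [sub_zero] at h
    refine h.congr fun n => ?_
    rw [digamma_add_nat (by positivity), digamma_add_nat one_pos, Finset.sum_sub_distrib]
    ring
  · intro n
    refine sub_nonneg.2 (inv_anti₀ (by positivity) (by linarith))

theorem integral_exp_mul_neg_log_one_sub_exp {b d : ℝ} (hb : 0 < b) (hd : 0 < d) :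
    ∫ x in Set.Iic (0 : ℝ), b * Real.exp (b * x) * -Real.log (1 - Real.exp (d * x)) =
      digamma (1 + b / d) - digamma 1 := by
  set F : ℕ → ℝ → ℝ := fun n x => b / (n + 1) * Real.exp ((b + d * (n + 1)) * x) with hF
  have hrate (n : ℕ) : 0 < b + d * (n + 1) := by positivity
  have hint (n : ℕ) : Integrable (F n) (volume.restrict (Set.Iic 0)) :=
    (integrableOn_exp_mul_Iic (hrate n) 0).const_mul _
  have hval (n : ℕ) :
      ∫ x in Set.Iic (0 : ℝ), F n x = ((1 : ℝ) + n)⁻¹ - (1 + b / d + n)⁻¹ := by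
    have hne : 1 + b / d + n ≠ 0 := by positivity
    have hr := (hrate n).ne'
    rw [integral_const_mul, integral_exp_mul_Iic (hrate n), mul_zero, Real.exp_zero]
    have hn : (1 : ℝ) + n ≠ 0 := by positivity
    have hrw : 1 + b / d + n = (b + d * (n + 1)) / d := by field_simp; ring
    rw [hrw]
    field_simp
    ring
  have hnorm (n : ℕ) (x : ℝ) : ‖F n x‖ = F n x := Real.norm_of_nonneg (by positivity)
  have hsum := hasSum_digamma_one_add_sub (a := b / d) (by positivity)
  have hmain := hasSum_integral_of_summable_integral_norm hint
    (by simpa only [hnorm, hval] using hsum.summable)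
  simp only [hval] at hmain
  rw [hsum.unique hmain, integral_Iic_eq_integral_Iio, integral_Iic_eq_integral_Iio]
  refine setIntegral_congr_fun measurableSet_Iio fun x hx => ?_
  have hlt : |Real.exp (d * x)| < 1 := by
    rw [abs_of_pos (Real.exp_pos _), Real.exp_lt_one_iff]
    exact mul_neg_of_pos_of_neg hd hx
  refine (((Real.hasSum_pow_div_log_of_abs_lt_one hlt).mul_left
    (b * Real.exp (b * x))).congr_fun ?_).tsum_eq.symm
  intro n
  have hexp : Real.exp ((b + d * (n + 1)) * x)
      = Real.exp (b * x) * Real.exp (d * x) ^ (n + 1) := by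
    rw [← Real.exp_nat_mul, ← Real.exp_add]
    push_cast
    ring_nf
  simp only [hF, hexp]
  ring

theorem digamma_one_lt {a : ℝ} (ha : 0 < a) : digamma 1 < digamma (1 + a) := by
  have h := hasSum_digamma_one_add_sub ha.le
  refine sub_pos.1 (h.tsum_eq ▸ h.summable.tsum_pos (fun n => ?_) 0 ?_)
  · exact sub_nonneg.2 (inv_anti₀ (by positivity) (by linarith))
  · exact sub_pos.2 (inv_strictAnti₀ (by positivity) (by linarith))

theorem integrableOn_exp_mul_neg_log_one_sub_exp {b d : ℝ} (hb : 0 < b) (hd : 0 < d) :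
    IntegrableOn (fun x => b * Real.exp (b * x) * -Real.log (1 - Real.exp (d * x)))
      (Set.Iic 0) := by
  refine Integrable.of_integral_ne_zero ?_
  rw [integral_exp_mul_neg_log_one_sub_exp hb hd]
  exact (sub_pos.2 (digamma_one_lt (by positivity))).ne'

/-- Kullback-Leibler divergence of `f_{j,k}` from `f_j`. -/
theorem KL_div_fj_fjk (j k : ℕ) (hj : 1 ≤ j) (hjk : j < k) :
    (∫ x in Set.Iic (0 : ℝ),
        ((j : ℝ) * Real.exp ((j : ℝ) * x)) *
          Real.log
            (((j : ℝ) * Real.exp ((j : ℝ) * x)) /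
              ((j : ℝ) * k / ((k : ℝ) - j) *
                (Real.exp ((j : ℝ) * x) - Real.exp ((k : ℝ) * x)))))
      = -Real.log ((k : ℝ) / ((k : ℝ) - j)) - digamma 1
        + digamma (1 + (j : ℝ) / ((k : ℝ) - j)) := by
  have hb : (0 : ℝ) < j := by exact_mod_cast hj
  have hd : (0 : ℝ) < (k : ℝ) - j := sub_pos.2 (by exact_mod_cast hjk)
  have hk : (0 : ℝ) < k := by linarith
  have hexp := integrableOn_exp_mul_Iic hb 0
  have hsplit : ∫ x in Set.Iic (0 : ℝ),
      (-Real.log ((k : ℝ) / ((k : ℝ) - j)) * j * Real.exp ((j : ℝ) * x) +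
        (j : ℝ) * Real.exp ((j : ℝ) * x) * -Real.log (1 - Real.exp (((k : ℝ) - j) * x))) =
      -Real.log ((k : ℝ) / ((k : ℝ) - j)) - digamma 1
        + digamma (1 + (j : ℝ) / ((k : ℝ) - j)) := by
    rw [integral_add (hexp.const_mul _) (integrableOn_exp_mul_neg_log_one_sub_exp hb hd),
      integral_exp_mul_neg_log_one_sub_exp hb hd, integral_const_mul,
      integral_exp_mul_Iic hb, mul_zero, Real.exp_zero]
    field_simp
    ring
  rw [← hsplit, integral_Iic_eq_integral_Iio, integral_Iic_eq_integral_Iio]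
  refine setIntegral_congr_fun measurableSet_Iio fun x hx => ?_
  have hpos : 0 < 1 - Real.exp (((k : ℝ) - j) * x) :=
    sub_pos.2 (Real.exp_lt_one_iff.2 (mul_neg_of_pos_of_neg hd hx))
  have hratio : ((j : ℝ) * Real.exp ((j : ℝ) * x)) /
      ((j : ℝ) * k / ((k : ℝ) - j) * (Real.exp ((j : ℝ) * x) - Real.exp ((k : ℝ) * x))) =
      ((k : ℝ) / ((k : ℝ) - j) * (1 - Real.exp (((k : ℝ) - j) * x)))⁻¹ := by
    have hfac : Real.exp ((j : ℝ) * x) - Real.exp ((k : ℝ) * x) =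
        Real.exp ((j : ℝ) * x) * (1 - Real.exp (((k : ℝ) - j) * x)) := by
      rw [mul_sub, mul_one, ← Real.exp_add]
      ring_nf
    have hE := (Real.exp_pos ((j : ℝ) * x)).ne'
    rw [hfac]
    generalize Real.exp ((j : ℝ) * x) = E at hE
    generalize 1 - Real.exp (((k : ℝ) - j) * x) = q at hpos
    field_simp
  simp only [hratio]
  rw [Real.log_inv, Real.log_mul (by positivity) hpos.ne']
  ring
end
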